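/- The number of unimodular triangulations of the square [0,3]×[0,3] is exactly 46456, i.e., f(3,3) = 46456. -/

import Mathlib

open Set

noncomputable section

/-- A point of the integer lattice `ℤ² ⊆ ℝ²`. -/
def IsLatticePoint (p : ℝ × ℝ) : Prop := ∃ a b : ℤ, p = ((a : ℝ), (b : ℝ))

/-- A triangle: the convex hull of three affinely independent points of `ℝ²`. -/
def IsTriangle (Δ : Set (ℝ × ℝ)) : Prop :=
  ∃ p q r : ℝ × ℝ, AffineIndependent ℝ ![p, q, r] ∧ Δ = convexHull ℝ {p, q, r}

/-- `F` is a face of the triangle `Δ`: the empty set, a vertex, an edge,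
or the whole triangle. -/
def IsFaceOf (F Δ : Set (ℝ × ℝ)) : Prop :=
  ∃ p q r : ℝ × ℝ, AffineIndependent ℝ ![p, q, r] ∧ Δ = convexHull ℝ {p, q, r} ∧
    (F = ∅ ∨ F = {p} ∨ F = {q} ∨ F = {r} ∨
     F = segment ℝ p q ∨ F = segment ℝ q r ∨ F = segment ℝ p r ∨ F = Δ)

/-- The determinant of the two edge vectors of the triangle `pqr` emanating
from `p`; its absolute value is twice the Euclidean area of the triangle. -/
def triDet (p q r : ℝ × ℝ) : ℝ :=
  (q.1 - p.1) * (r.2 - p.2) - (q.2 - p.2) * (r.1 - p.1)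

/-- A unimodular triangle: a lattice triangle of area `1/2`. -/
def IsUnimodularTriangle (Δ : Set (ℝ × ℝ)) : Prop :=
  ∃ p q r : ℝ × ℝ, IsLatticePoint p ∧ IsLatticePoint q ∧ IsLatticePoint r ∧
    AffineIndependent ℝ ![p, q, r] ∧ Δ = convexHull ℝ {p, q, r} ∧
    |triDet p q r| = 1

/-- `T` is a unimodular triangulation of the region `P`. -/
def IsUnimodularTriangulation (P : Set (ℝ × ℝ)) (T : Set (Set (ℝ × ℝ))) : Prop :=
  T.Finite ∧ (∀ Δ ∈ T, IsUnimodularTriangle Δ ∧ Δ ⊆ P) ∧ ⋃₀ T = P ∧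
  ∀ Δ₁ ∈ T, ∀ Δ₂ ∈ T, IsFaceOf (Δ₁ ∩ Δ₂) Δ₁ ∧ IsFaceOf (Δ₁ ∩ Δ₂) Δ₂

/-- The number of unimodular triangulations of the region `P`. -/
def numTriangulations (P : Set (ℝ × ℝ)) : ℕ :=
  Set.ncard {T | IsUnimodularTriangulation P T}

/-- `f m n` is the number of unimodular triangulations of `[0,m] × [0,n]`. -/
def f (m n : ℕ) : ℕ :=
  numTriangulations (Set.Icc (0, 0) ((m : ℝ), (n : ℝ)))

/-- `Δ₂` lies above `Δ₁` (written `Δ₁ ≺ Δ₂`). -/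
def LiesAbove (Δ₁ Δ₂ : Set (ℝ × ℝ)) : Prop :=
  ∃ x y₁ y₂ : ℝ, (x, y₁) ∈ Δ₁ \ Δ₂ ∧ (x, y₂) ∈ Δ₂ \ Δ₁ ∧ y₁ < y₂

/-- Sample points of the square, in units of `1/20`. -/
def samplePoints : List (ℕ × ℕ) :=
  [(1, 4), (1, 23), (1, 42), (2, 5), (2, 23), (2, 37), (2, 55), (3, 4), (3, 5), (3, 18), (3, 42),
   (3, 55), (3, 56), (4, 1), (4, 3), (4, 19), (4, 21), (4, 23), (4, 37), (4, 39), (4, 41),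
   (4, 57), (4, 59), (5, 2), (5, 3), (5, 18), (5, 22), (5, 23), (5, 37), (5, 38), (5, 42),
   (5, 57), (5, 58), (6, 15), (6, 29), (6, 44), (7, 17), (7, 18), (7, 41), (7, 43), (8, 13),
   (8, 25), (8, 26), (8, 33), (8, 35), (8, 37), (8, 45), (9, 12), (9, 16), (9, 24), (9, 35),
   (9, 36), (9, 44), (9, 47), (10, 17), (10, 21), (10, 37), (11, 10), (11, 21), (11, 30),
   (11, 41), (11, 44), (11, 50), (12, 17), (12, 43), (13, 8), (13, 15), (13, 28), (13, 36),
   (13, 52), (14, 19), (14, 41), (15, 6), (15, 11), (15, 21), (15, 26), (15, 31), (15, 33),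
   (15, 38), (15, 46), (15, 53), (16, 5), (16, 9), (16, 13), (16, 15), (16, 30), (16, 45),
   (16, 46), (16, 50), (16, 55), (17, 7), (17, 24), (17, 27), (17, 35), (17, 49), (17, 52),
   (18, 5), (18, 7), (18, 25), (18, 35), (18, 52), (18, 55), (19, 4), (19, 11), (19, 31),
   (19, 54), (21, 4), (21, 10), (21, 11), (21, 15), (21, 23), (21, 28), (21, 31), (21, 35),
   (21, 42), (21, 48), (21, 50), (21, 54), (22, 5), (22, 23), (22, 37), (22, 55), (23, 1),
   (23, 2), (23, 4), (23, 5), (23, 18), (23, 19), (23, 21), (23, 22), (23, 25), (23, 35),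
   (23, 38), (23, 39), (23, 41), (23, 42), (23, 55), (23, 56), (23, 58), (23, 59), (24, 9),
   (24, 49), (25, 8), (25, 13), (25, 24), (25, 29), (25, 31), (25, 37), (25, 52), (26, 8),
   (26, 15), (26, 29), (26, 44), (26, 52), (27, 37), (28, 7), (28, 13), (28, 15), (28, 19),
   (28, 22), (28, 27), (28, 33), (28, 47), (28, 53), (29, 12), (29, 17), (29, 23), (29, 35),
   (29, 41), (29, 43), (29, 47), (31, 5), (31, 14), (31, 21), (31, 30), (31, 35), (31, 46),
   (31, 55), (32, 9), (32, 17), (32, 25), (32, 41), (32, 51), (33, 15), (33, 35), (33, 37),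
   (33, 41), (33, 44), (34, 19), (34, 41), (35, 6), (35, 8), (35, 11), (35, 17), (35, 21),
   (35, 23), (35, 26), (35, 33), (35, 38), (35, 43), (35, 44), (35, 46), (35, 49), (35, 52),
   (35, 53), (36, 7), (36, 13), (36, 23), (36, 29), (36, 37), (36, 53), (37, 7), (37, 10),
   (37, 16), (37, 24), (37, 33), (37, 36), (37, 44), (37, 48), (37, 53), (38, 7), (38, 25),
   (38, 35), (38, 52), (38, 53), (39, 28), (41, 4), (41, 7), (41, 11), (41, 14), (41, 23),
   (41, 27), (41, 30), (41, 32), (41, 33), (41, 34), (41, 42), (41, 47), (41, 48), (41, 51),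
   (41, 54), (42, 1), (42, 3), (42, 5), (42, 19), (42, 21), (42, 23), (42, 37), (42, 39),
   (42, 41), (42, 55), (42, 57), (42, 59), (43, 7), (43, 52), (44, 6), (44, 9), (44, 26),
   (44, 33), (44, 35), (44, 49), (44, 50), (44, 53), (45, 8), (45, 13), (45, 23), (45, 51),
   (46, 5), (46, 10), (46, 16), (46, 29), (46, 30), (46, 31), (46, 35), (46, 45), (46, 49),
   (46, 55), (48, 7), (48, 13), (48, 15), (48, 19), (48, 41), (48, 47), (48, 53), (49, 8),
   (49, 23), (49, 24), (49, 35), (49, 37), (49, 52), (50, 16), (50, 44), (51, 10), (51, 14),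
   (51, 19), (51, 28), (51, 30), (51, 32), (51, 41), (51, 45), (51, 50), (52, 17), (52, 25),
   (52, 35), (52, 37), (52, 43), (53, 11), (53, 15), (53, 22), (53, 23), (53, 24), (53, 25),
   (53, 35), (53, 36), (53, 37), (53, 38), (53, 44), (53, 48), (54, 13), (54, 19), (54, 27),
   (54, 33), (54, 41), (54, 47), (55, 16), (55, 18), (55, 42), (55, 43), (56, 13), (56, 29),
   (56, 45)]

/-- A triple of grid points, thought of as the vertices of a triangle. -/
abbrev GridTriple := (ℕ × ℕ) × (ℕ × ℕ) × (ℕ × ℕ)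

/-- The lattice points of the square `[0,3] × [0,3]`, in lexicographic order. -/
def gridPoints : List (ℕ × ℕ) :=
  [(0, 0), (0, 1), (0, 2), (0, 3), (1, 0), (1, 1), (1, 2), (1, 3),
   (2, 0), (2, 1), (2, 2), (2, 3), (3, 0), (3, 1), (3, 2), (3, 3)]

/-- The position of a grid point in the lexicographic order. -/
def gridIndex (p : ℕ × ℕ) : ℕ := 4 * p.1 + p.2

/-- The triple `p, q, r` spans a positively oriented triangle of area `1/2`. -/
def isUnimodular (p q r : ℕ × ℕ) : Bool :=
  Nat.beq (p.2 * q.1 + q.2 * r.1 + r.2 * p.1 + 1) (p.1 * q.2 + q.1 * r.2 + r.1 * p.2)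

/-- The unimodular triangles of the square, each listed once: positively oriented and
starting from the lexicographically least vertex. -/
def gridTriangles : List GridTriple :=
  gridPoints.flatMap fun p =>
    (gridPoints.filter fun q => Nat.blt (gridIndex p) (gridIndex q)).flatMap fun q =>
      (gridPoints.filter fun r => Nat.blt (gridIndex p) (gridIndex r) && isUnimodular p q r).map
        fun r => (p, q, r)

/-- The sample point `s / 20` lies on the left of the line from `p` to `q`, or on it. -/
def onLeft (p q s : ℕ × ℕ) : Bool :=
  Nat.ble (Nat.add (Nat.add (Nat.mul s.1 q.2) (Nat.mul s.2 p.1)) (Nat.mul 20 (Nat.mul p.2 q.1)))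
    (Nat.add (Nat.add (Nat.mul s.1 p.2) (Nat.mul s.2 q.1)) (Nat.mul 20 (Nat.mul p.1 q.2)))

/-- The sample point `s / 20` lies strictly on the left of the line from `p` to `q`. -/
def strictlyOnLeft (p q s : ℕ × ℕ) : Bool :=
  Nat.blt (Nat.add (Nat.add (Nat.mul s.1 q.2) (Nat.mul s.2 p.1)) (Nat.mul 20 (Nat.mul p.2 q.1)))
    (Nat.add (Nat.add (Nat.mul s.1 p.2) (Nat.mul s.2 q.1)) (Nat.mul 20 (Nat.mul p.1 q.2)))

/-- The sample point `s / 20` lies in the triangle `t`. -/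
def inClosed (t : GridTriple) (s : ℕ × ℕ) : Bool :=
  onLeft t.1 t.2.1 s && (onLeft t.2.1 t.2.2 s && onLeft t.2.2 t.1 s)

/-- The sample point `s / 20` lies in the interior of the triangle `t`. -/
def inOpen (t : GridTriple) (s : ℕ × ℕ) : Bool :=
  strictlyOnLeft t.1 t.2.1 s && (strictlyOnLeft t.2.1 t.2.2 s && strictlyOnLeft t.2.2 t.1 s)

/-- The set of indices of the points of a list lying in the triangle `t`, as a bit mask. -/
def maskOn (t : GridTriple) : List (ℕ × ℕ) → ℕ
  | [] => 0
  | s :: l => bif inClosed t s then Nat.add (Nat.mul 2 (maskOn t l)) 1 else Nat.mul 2 (maskOn t l)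

/-- The set of sample points lying in the triangle `t`, as a bit mask. -/
def mask (t : GridTriple) : ℕ := maskOn t samplePoints

/-- Evaluate a natural number before passing it on. -/
def force {α : Type} (n : ℕ) (k : ℕ → α) : α := Nat.rec (k 0) (fun n _ => k n.succ) n

/-- Evaluate a list of natural numbers before passing it on. -/
def forceList (l : List ℕ) : (List ℕ → ℕ) → ℕ :=
  List.rec (fun k => k []) (fun n _ ih k => force n fun n => ih fun l => k (n :: l)) l

/-- Add the weight `c` to the state `S` of a weighted list of states, evaluating eagerly. -/
def addWeight (S c : ℕ) (l : List (ℕ × ℕ)) : (List (ℕ × ℕ) → ℕ) → ℕ :=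
  List.rec (fun k => k [(S, c)])
    (fun e l ih k => bif Nat.beq S e.1 then force (Nat.add c e.2) fun c => k ((S, c) :: l)
      else ih fun l => k (e :: l)) l

/-- Add the states obtained from `S` by removing one of the masks `ms` containing its top bit. -/
def addSuccessors (S c : ℕ) (ms : List ℕ) :
    List (ℕ × ℕ) → (List (ℕ × ℕ) → ℕ) → ℕ :=
  List.rec (fun acc k => k acc)
    (fun m _ ih acc k => bif Nat.blt (Nat.xor S m) m && Nat.beq (Nat.land m S) m then
      force (Nat.xor S m) fun S' => addWeight S' c acc fun acc => ih acc k
    else ih acc k) ms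

/-- Replace every state of a weighted list by its successors. -/
def expand (ms : List ℕ) (l : List (ℕ × ℕ)) :
    List (ℕ × ℕ) → (List (ℕ × ℕ) → ℕ) → ℕ :=
  List.rec (fun acc k => k acc)
    (fun e _ ih acc k => addSuccessors e.1 e.2 ms acc fun acc => ih acc k) l

/-- The total weight of the empty state after `n` rounds of expansion. -/
def weightAfter (ms : List ℕ) : ℕ → List (ℕ × ℕ) → ℕ
  | 0, l => (l.map fun e => bif Nat.beq e.1 0 then e.2 else 0).sum
  | n + 1, l => expand ms l [] fun l => weightAfter ms n l

/-- Normal vectors of lines separating the triangles of the square: the pair `(a, b)` stands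
for the vector `a - b`. -/
def directions : List ((ℕ × ℕ) × (ℕ × ℕ)) :=
  [((5, 3), (0, 0)), ((5, 0), (0, 3)), ((0, 4), (1, 0)), ((3, 5), (0, 0)), ((3, 0), (0, 4)),
   ((4, 0), (0, 1)), ((4, 1), (0, 0)), ((0, 0), (1, 4)), ((0, 5), (3, 0)), ((1, 0), (0, 0)),
   ((2, 5), (0, 0)), ((0, 3), (4, 0)), ((1, 1), (0, 0)), ((0, 1), (0, 0)), ((0, 0), (0, 1)),
   ((1, 0), (0, 1)), ((2, 0), (0, 5)), ((0, 1), (1, 0)), ((2, 1), (0, 0)), ((0, 1), (2, 0)),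
   ((1, 2), (0, 0)), ((0, 2), (1, 0)), ((3, 4), (0, 0)), ((0, 0), (3, 5)), ((5, 2), (0, 0)),
   ((1, 0), (0, 2)), ((2, 0), (0, 1)), ((4, 3), (0, 0)), ((0, 0), (1, 1)), ((0, 5), (2, 0)),
   ((0, 0), (1, 2)), ((0, 2), (5, 0)), ((0, 3), (5, 0)), ((5, 0), (0, 2)), ((0, 1), (3, 0)),
   ((0, 3), (1, 0)), ((1, 3), (0, 0)), ((3, 1), (0, 0)), ((0, 2), (3, 0)), ((0, 3), (2, 0)),
   ((2, 3), (0, 0)), ((3, 2), (0, 0)), ((0, 0), (4, 3)), ((1, 4), (0, 0)), ((4, 0), (0, 3))]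

/-- The value at `p` of a linear functional, raised by `50` to make it a natural number. -/
def score (d : (ℕ × ℕ) × (ℕ × ℕ)) (p : ℕ × ℕ) : ℕ :=
  Nat.sub (Nat.add 50 (Nat.add (Nat.mul d.1.1 p.1) (Nat.mul d.1.2 p.2)))
    (Nat.add (Nat.mul d.2.1 p.1) (Nat.mul d.2.2 p.2))

/-- The vertices of a triangle, as a list. -/
def vertexList (t : GridTriple) : List (ℕ × ℕ) := [t.1, t.2.1, t.2.2]

/-- The largest value of a score on `V` is at most its least value on `W`, and in the case of
equality these values are attained at common points only. -/
def separates (V W : List (ℕ × ℕ)) (d : (ℕ × ℕ) × (ℕ × ℕ)) : Bool :=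
  force ((V.map (score d)).foldl max 0) fun c =>
    (W.all fun w => Nat.ble c (score d w)) &&
      ((W.all fun w => Nat.blt c (score d w)) ||
        ((V.all fun v => Nat.blt (score d v) c || decide (v ∈ W)) &&
          W.all fun w => Nat.blt c (score d w) || decide (w ∈ V)))

/-- Two triangles with different masks have a sample point in common or are separated. -/
def pairOk (a b : ℕ × GridTriple) : Bool :=
  !Nat.beq a.1 b.1 && (!Nat.beq (Nat.land a.1 b.1) 0 ||
    directions.any (separates (vertexList a.2) (vertexList b.2)))

/-- A Boolean relation holds between each entry of a list and the later entries. -/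
def pairwiseB {α : Type} (r : α → α → Bool) : List α → Bool
  | [] => true
  | a :: l => l.all (r a) && pairwiseB r l

/-- Attach the masks to a list of triangles, evaluating eagerly. -/
def withMasks (l : List GridTriple) : (List (ℕ × GridTriple) → Bool) → Bool :=
  List.rec (fun k => k []) (fun t _ ih k => force (mask t) fun m => ih fun l => k ((m, t) :: l)) l

open Classical in
/-- The `k`-element subfamilies of `U` whose bit masks `g` partition the bit mask `S`. -/
def exactCovers {α : Type*} (U : Finset α) (g : α → ℕ) (k S : ℕ) : Finset (Finset α) :=
  (U.powersetCard k).filter fun X =>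
    ∀ i, (X.filter fun t => (g t).testBit i).card = (S.testBit i).toNat

theorem mem_exactCovers {α : Type*} {U : Finset α} {g : α → ℕ} {k S : ℕ} {X : Finset α} :
    X ∈ exactCovers U g k S ↔ X ⊆ U ∧ X.card = k ∧
      ∀ i, (X.filter fun t => (g t).testBit i).card = (S.testBit i).toNat := by
  classical
  rw [exactCovers, Finset.mem_filter, Finset.mem_powersetCard, and_assoc]

theorem card_exactCovers_zero {α : Type*} (U : Finset α) (g : α → ℕ) (S : ℕ) :
    (exactCovers U g 0 S).card = if S = 0 then 1 else 0 := by
  split_ifs with h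
  · rw [Finset.card_eq_one]
    refine ⟨∅, Finset.ext fun X => ?_⟩
    rw [mem_exactCovers, Finset.mem_singleton, Finset.card_eq_zero]
    refine ⟨fun h => h.2.1, ?_⟩
    rintro rfl
    simp [h]
  · rw [Finset.card_eq_zero, Finset.eq_empty_iff_forall_notMem]
    intro X hX
    rw [mem_exactCovers, Finset.card_eq_zero] at hX
    obtain ⟨-, rfl, hX⟩ := hX
    refine h (Nat.eq_of_testBit_eq fun i => ?_)
    have := hX i
    simp only [Finset.filter_empty, Finset.card_empty] at this
    rw [Nat.zero_testBit]
    exact Bool.toNat_eq_zero.1 this.symm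

/-- `m` is a submask of `S` containing its top bit. -/
def IsTopSubmask (S m : ℕ) : Prop := S ^^^ m < m ∧ m &&& S = m

instance (S m : ℕ) : Decidable (IsTopSubmask S m) := inferInstanceAs (Decidable (_ ∧ _))

theorem land_eq_left_iff_testBit {S m : ℕ} :
    m &&& S = m ↔ ∀ i, m.testBit i = true → S.testBit i = true := by
  constructor
  · intro h i hi
    rw [← h, Nat.testBit_land] at hi
    simp_all
  · intro h
    refine Nat.eq_of_testBit_eq fun i => ?_
    rw [Nat.testBit_land]
    have := h i
    cases hm : m.testBit i <;> simp_all

theorem isTopSubmask_iff {S m : ℕ} (hS : S ≠ 0) :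
    IsTopSubmask S m ↔ m.testBit S.log2 = true ∧ m &&& S = m := by
  refine and_congr_left fun hm => ?_
  have hbit : S.testBit S.log2 = true := Nat.testBit_log2 hS
  have hlt : S < 2 ^ (S.log2 + 1) := Nat.lt_log2_self
  have hmS : m ≤ S := hm ▸ Nat.and_le_right
  have lt_of_bit : ∀ {n}, n < 2 ^ (S.log2 + 1) → n.testBit S.log2 = false → n < 2 ^ S.log2 := by
    intro n hn hb
    refine Nat.lt_pow_two_of_testBit n fun i hi => ?_
    rcases hi.eq_or_lt with rfl | hi
    · exact hb
    · exact Nat.testBit_lt_two_pow (hn.trans_le (Nat.pow_le_pow_right two_pos hi))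
  constructor
  · intro h
    by_contra hb
    rw [Bool.not_eq_true] at hb
    have h1 := lt_of_bit (hmS.trans_lt hlt) hb
    have h2 : (S ^^^ m).testBit S.log2 = true := by rw [Nat.testBit_xor, hbit, hb]; rfl
    exact absurd (Nat.ge_two_pow_of_testBit h2) (by omega)
  · intro hb
    have h2 : (S ^^^ m).testBit S.log2 = false := by rw [Nat.testBit_xor, hbit, hb]; rfl
    have h3 := lt_of_bit (Nat.xor_lt_two_pow hlt (hmS.trans_lt hlt)) h2
    exact h3.trans_le (Nat.ge_two_pow_of_testBit hb)

theorem testBit_xor_of_land_eq {S m : ℕ} (h : m &&& S = m) (i : ℕ) :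
    (S.testBit i).toNat = (m.testBit i).toNat + ((S ^^^ m).testBit i).toNat := by
  have := land_eq_left_iff_testBit.1 h i
  rw [Nat.testBit_xor]
  cases hm : m.testBit i <;> cases hS : S.testBit i <;> simp_all

theorem card_filter_insert {α : Type*} [DecidableEq α] (p : α → Bool) {t : α} {X : Finset α}
    (ht : t ∉ X) :
    ((insert t X).filter fun u => p u).card = (p t).toNat + (X.filter fun u => p u).card := by
  rw [Finset.filter_insert]
  cases h : p t
  · simp
  · rw [if_pos rfl, Finset.card_insert_of_notMem (by simp [ht])]
    simp [add_comm]

/-- Removing a fixed member with mask `g t` from the exact covers of `S` containing it. -/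
theorem card_exactCovers_filter_mem {α : Type*} [DecidableEq α] {U : Finset α} {g : α → ℕ}
    {k S : ℕ} {t : α} (htU : t ∈ U) (hg : g t ≠ 0) (hS : g t &&& S = g t) :
    ((exactCovers U g (k + 1) S).filter (t ∈ ·)).card = (exactCovers U g k (S ^^^ g t)).card := by
  have notMem : ∀ X ∈ exactCovers U g k (S ^^^ g t), t ∉ X := by
    intro X hX ht
    obtain ⟨i, hi⟩ := Nat.exists_testBit_of_ne_zero hg
    have h1 := (mem_exactCovers.1 hX).2.2 i
    have h2 := land_eq_left_iff_testBit.1 hS i hi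
    rw [Nat.testBit_xor, hi, h2, Bool.xor_self, Bool.toNat_false, Finset.card_eq_zero] at h1
    have : t ∈ X.filter fun t => (g t).testBit i := by simp [ht, hi]
    simp [h1] at this
  refine Finset.card_nbij' (fun X => X.erase t) (fun X => insert t X) ?_ ?_ ?_ ?_
  · intro X hX
    obtain ⟨hX, ht⟩ := Finset.mem_filter.1 hX
    obtain ⟨hXU, hc, hb⟩ := mem_exactCovers.1 hX
    refine mem_exactCovers.2 ⟨(Finset.erase_subset _ _).trans hXU, ?_, fun i => ?_⟩
    · rw [Finset.card_erase_of_mem ht, hc, Nat.add_sub_cancel]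
    · have h1 := card_filter_insert (fun u => (g u).testBit i) (Finset.notMem_erase t X)
      rw [Finset.insert_erase ht, hb i, testBit_xor_of_land_eq hS i] at h1
      exact (Nat.add_left_cancel h1).symm
  · intro X hX
    have ht := notMem X hX
    obtain ⟨hXU, hc, hb⟩ := mem_exactCovers.1 hX
    refine Finset.mem_filter.2 ⟨mem_exactCovers.2 ⟨Finset.insert_subset htU hXU, ?_, fun i => ?_⟩,
      Finset.mem_insert_self _ _⟩
    · rw [Finset.card_insert_of_notMem ht, hc]
    · rw [card_filter_insert (fun u => (g u).testBit i) ht, hb i, testBit_xor_of_land_eq hS i]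
  · intro X hX
    exact Finset.insert_erase (Finset.mem_filter.1 hX).2
  · intro X hX
    exact Finset.erase_insert (notMem X hX)

theorem land_eq_of_mem_exactCovers {α : Type*} {U : Finset α} {g : α → ℕ} {k S : ℕ}
    {X : Finset α} (hX : X ∈ exactCovers U g k S) {t : α} (ht : t ∈ X) : g t &&& S = g t := by
  refine land_eq_left_iff_testBit.2 fun i hi => ?_
  have h1 := (mem_exactCovers.1 hX).2.2 i
  by_contra h
  rw [Bool.not_eq_true] at h
  rw [h, Bool.toNat_false, Finset.card_eq_zero] at h1
  have : t ∈ X.filter fun t => (g t).testBit i := by simp [ht, hi]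
  simp [h1] at this

/-- The recursion for exact covers: branch over the member containing the top bit. -/
theorem card_exactCovers_succ {α : Type*} [DecidableEq α] {U : Finset α} {g : α → ℕ}
    (hg : ∀ t ∈ U, g t ≠ 0) (k S : ℕ) :
    (exactCovers U g (k + 1) S).card =
      ∑ t ∈ U with IsTopSubmask S (g t), (exactCovers U g k (S ^^^ g t)).card := by
  rcases eq_or_ne S 0 with rfl | hS
  · have h1 : U.filter (fun t => IsTopSubmask 0 (g t)) = ∅ := by
      refine Finset.filter_eq_empty_iff.2 fun t ht h => hg t ht ?_
      simpa using h.2.symm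
    rw [h1, Finset.sum_empty, Finset.card_eq_zero, Finset.eq_empty_iff_forall_notMem]
    intro X hX
    obtain ⟨hXU, hc, -⟩ := mem_exactCovers.1 hX
    obtain ⟨t, ht⟩ := Finset.card_pos.1 (show 0 < X.card by omega)
    have := land_eq_of_mem_exactCovers hX ht
    exact hg t (hXU ht) (by simpa using this.symm)
  · have key : ∀ X ∈ exactCovers U g (k + 1) S,
        ∑ t ∈ U with IsTopSubmask S (g t), (if t ∈ X then 1 else 0) = 1 := by
      intro X hX
      have h1 := (mem_exactCovers.1 hX).2.2 S.log2
      rw [Nat.testBit_log2 hS, Bool.toNat_true] at h1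
      rw [Finset.sum_boole, Finset.filter_filter, Nat.cast_id, ← h1]
      congr 1
      ext t
      simp only [Finset.mem_filter]
      rw [isTopSubmask_iff hS]
      constructor
      · rintro ⟨-, ⟨h, -⟩, ht⟩
        exact ⟨ht, h⟩
      · rintro ⟨ht, h⟩
        exact ⟨(mem_exactCovers.1 hX).1 ht, ⟨h, land_eq_of_mem_exactCovers hX ht⟩, ht⟩
    rw [Finset.card_eq_sum_ones, ← Finset.sum_congr rfl key, Finset.sum_comm]
    refine Finset.sum_congr rfl fun t ht => ?_
    obtain ⟨htU, ht⟩ := Finset.mem_filter.1 ht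
    rw [Finset.sum_boole, Nat.cast_id]
    exact card_exactCovers_filter_mem htU (hg t htU) ht.2

theorem force_eq {α : Type} (n : ℕ) (k : ℕ → α) : force n k = k n := by
  cases n <;> rfl

theorem forceList_eq (l : List ℕ) (k : List ℕ → ℕ) : forceList l k = k l := by
  induction l generalizing k with
  | nil => rfl
  | cons n l ih =>
    change force n (fun n => forceList l fun l => k (n :: l)) = _
    rw [force_eq, ih]

/-- The sum of `F` over a weighted list of states. -/
def weightedSum (F : ℕ → ℕ) (l : List (ℕ × ℕ)) : ℕ := (l.map fun e => e.2 * F e.1).sum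

theorem weightedSum_cons (F : ℕ → ℕ) (e : ℕ × ℕ) (l : List (ℕ × ℕ)) :
    weightedSum F (e :: l) = e.2 * F e.1 + weightedSum F l := rfl

theorem addWeight_spec (S c : ℕ) (l : List (ℕ × ℕ)) :
    ∃ l', (∀ k, addWeight S c l k = k l') ∧
      ∀ F, weightedSum F l' = c * F S + weightedSum F l := by
  induction l with
  | nil => exact ⟨[(S, c)], fun _ => rfl, fun _ => rfl⟩
  | cons e l ih =>
    have cons_eq : ∀ k, addWeight S c (e :: l) k = bif Nat.beq S e.1 then
        force (Nat.add c e.2) fun c => k ((S, c) :: l)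
        else addWeight S c l fun l => k (e :: l) := fun _ => rfl
    simp only [cons_eq, force_eq]
    cases h : Nat.beq S e.1
    · obtain ⟨l', h1, h2⟩ := ih
      refine ⟨e :: l', fun k => h1 _, fun F => ?_⟩
      rw [weightedSum_cons, weightedSum_cons, h2]
      ring
    · refine ⟨(S, c + e.2) :: l, fun k => rfl, fun F => ?_⟩
      rw [weightedSum_cons, weightedSum_cons, ← Nat.eq_of_beq_eq_true h]
      ring

/-- The sum of `F` over the successors of a state. -/
def successorSum (ms : List ℕ) (F : ℕ → ℕ) (S : ℕ) : ℕ :=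
  ((ms.filter fun m => IsTopSubmask S m).map fun m => F (S ^^^ m)).sum

theorem addSuccessors_spec (S c : ℕ) (ms : List ℕ) (acc : List (ℕ × ℕ)) :
    ∃ l', (∀ k, addSuccessors S c ms acc k = k l') ∧
      ∀ F, weightedSum F l' = c * successorSum ms F S + weightedSum F acc := by
  induction ms generalizing acc with
  | nil => exact ⟨acc, fun _ => rfl, fun F => by simp [successorSum]⟩
  | cons m ms ih =>
    have cons_eq : ∀ k, addSuccessors S c (m :: ms) acc k =
        bif Nat.blt (Nat.xor S m) m && Nat.beq (Nat.land m S) m then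
          force (Nat.xor S m) fun S' => addWeight S' c acc fun acc => addSuccessors S c ms acc k
        else addSuccessors S c ms acc k := fun _ => rfl
    have hc : (Nat.blt (Nat.xor S m) m && Nat.beq (Nat.land m S) m) =
        decide (IsTopSubmask S m) := by
      rw [Bool.eq_iff_iff, Bool.and_eq_true, decide_eq_true_iff, Nat.blt_eq, Nat.beq_eq]
      rfl
    simp only [cons_eq, force_eq, hc, successorSum, List.filter_cons]
    cases decide (IsTopSubmask S m)
    · exact ih acc
    · obtain ⟨acc', h1, h2⟩ := addWeight_spec (S ^^^ m) c acc
      obtain ⟨l', h3, h4⟩ := ih acc'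
      refine ⟨l', fun k => (h1 _).trans (h3 k), fun F => ?_⟩
      rw [h4, h2, if_pos rfl, List.map_cons, List.sum_cons, successorSum]
      ring

theorem expand_spec (ms : List ℕ) (l acc : List (ℕ × ℕ)) :
    ∃ l', (∀ k, expand ms l acc k = k l') ∧
      ∀ F, weightedSum F l' = weightedSum (successorSum ms F) l + weightedSum F acc := by
  induction l generalizing acc with
  | nil => exact ⟨acc, fun _ => rfl, fun F => (Nat.zero_add _).symm⟩
  | cons e l ih =>
    obtain ⟨acc', h1, h2⟩ := addSuccessors_spec e.1 e.2 ms acc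
    obtain ⟨l', h3, h4⟩ := ih acc'
    refine ⟨l', fun k => (h1 _).trans (h3 k), fun F => ?_⟩
    rw [h4, h2, weightedSum_cons]
    ring

theorem weightAfter_eq {α : Type*} [DecidableEq α] {L : List α} (hL : L.Nodup) {g : α → ℕ}
    (hg : ∀ t ∈ L, g t ≠ 0) (n : ℕ) (l : List (ℕ × ℕ)) :
    weightAfter (L.map g) n l =
      weightedSum (fun S => (exactCovers L.toFinset g n S).card) l := by
  induction n generalizing l with
  | zero =>
    refine congrArg List.sum (List.map_congr_left fun e _ => ?_)
    simp only [card_exactCovers_zero]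
    by_cases h : e.1 = 0
    · simp [h]
    · have : Nat.beq e.1 0 = false := Bool.eq_false_iff.2 (mt Nat.eq_of_beq_eq_true h)
      rw [if_neg h, this]
      simp
  | succ n ih =>
    obtain ⟨l', h1, h2⟩ := expand_spec (L.map g) l []
    have : (fun S => (exactCovers L.toFinset g (n + 1) S).card) =
        successorSum (L.map g) fun S => (exactCovers L.toFinset g n S).card := by
      funext S
      rw [card_exactCovers_succ (by simpa using hg), successorSum, List.filter_map, List.map_map,
        ← List.sum_toFinset _ (hL.filter _), List.toFinset_filter]
      simp
    rw [this, ← Nat.add_zero (weightedSum _ l)]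
    exact (h1 _).trans ((ih l').trans (h2 _))

theorem triDet_comm (p q r : ℝ × ℝ) : triDet q p r = -triDet p q r := by
  simp only [triDet]; ring

theorem triDet_rotate (p q r : ℝ × ℝ) : triDet q r p = triDet p q r := by
  simp only [triDet]; ring

theorem triDet_combo (p q x y : ℝ × ℝ) {a b : ℝ} (h : a + b = 1) :
    triDet p q (a • x + b • y) = a * triDet p q x + b * triDet p q y := by
  obtain rfl : b = 1 - a := by linarith
  simp only [triDet, Prod.fst_add, Prod.snd_add, Prod.smul_fst, Prod.smul_snd, smul_eq_mul]
  ring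

theorem continuous_triDet (p q : ℝ × ℝ) : Continuous (triDet p q) := by
  unfold triDet; fun_prop

theorem affineIndependent_iff_triDet_ne_zero {p q r : ℝ × ℝ} :
    AffineIndependent ℝ ![p, q, r] ↔ triDet p q r ≠ 0 := by
  rw [affineIndependent_iff_not_collinear_set, not_iff_not,
    collinear_iff_of_mem (Set.mem_insert p {q, r})]
  constructor
  · rintro ⟨v, h⟩
    obtain ⟨a, ha⟩ := h q (by simp)
    obtain ⟨b, hb⟩ := h r (by simp)
    simp only [triDet, ha, hb, vadd_eq_add, Prod.fst_add, Prod.snd_add, Prod.smul_fst,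
      Prod.smul_snd, smul_eq_mul]
    ring
  · intro h
    by_cases hq : q = p
    · refine ⟨r - p, ?_⟩
      simp only [Set.mem_insert_iff, Set.mem_singleton_iff, forall_eq_or_imp, forall_eq, hq]
      exact ⟨⟨0, by simp⟩, ⟨0, by simp⟩, ⟨1, by simp⟩⟩
    · refine ⟨q - p, ?_⟩
      simp only [Set.mem_insert_iff, Set.mem_singleton_iff, forall_eq_or_imp, forall_eq]
      refine ⟨⟨0, by simp⟩, ⟨1, by simp⟩, ?_⟩
      simp only [triDet] at h
      by_cases h1 : q.1 - p.1 = 0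
      · have h2 : q.2 - p.2 ≠ 0 := fun h2 => hq (Prod.ext (by linarith) (by linarith))
        refine ⟨(r.2 - p.2) / (q.2 - p.2), Prod.ext ?_ ?_⟩
        · have : r.1 - p.1 = 0 := by
            rw [h1, zero_mul, zero_sub, neg_eq_zero] at h
            exact (mul_eq_zero.1 h).resolve_left h2
          simp [h1]
          linarith
        · simp [h2]
      · refine ⟨(r.1 - p.1) / (q.1 - p.1), Prod.ext ?_ ?_⟩
        · simp [h1]
        · simp
          field_simp
          linarith

theorem mem_convexHull_triangle_iff {p q r : ℝ × ℝ} (h : 0 < triDet p q r) {x : ℝ × ℝ} :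
    x ∈ convexHull ℝ {p, q, r} ↔ 0 ≤ triDet p q x ∧ 0 ≤ triDet q r x ∧ 0 ≤ triDet r p x := by
  constructor
  · suffices convexHull ℝ {p, q, r} ⊆
        {x | 0 ≤ triDet p q x ∧ 0 ≤ triDet q r x ∧ 0 ≤ triDet r p x} from fun hx => this hx
    refine convexHull_min ?_ ?_
    · have h0 : ∀ a b, triDet a b a = 0 := fun a b => by simp only [triDet]; ring
      have h1 : ∀ a b, triDet a b b = 0 := fun a b => by simp only [triDet]; ring
      have h2 : triDet q r p = triDet p q r := triDet_rotate ..
      have h3 : triDet r p q = triDet p q r := by rw [triDet_rotate, triDet_rotate]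
      rintro x (rfl | rfl | rfl) <;> simp [h0, h1, h2, h3, h.le]
    · intro x hx y hy a b ha hb hab
      simp only [Set.mem_ofPred_eq, triDet_combo _ _ _ _ hab] at *
      have := hx.1; have := hx.2.1; have := hx.2.2
      have := hy.1; have := hy.2.1; have := hy.2.2
      refine ⟨?_, ?_, ?_⟩ <;> positivity
  · rintro ⟨h1, h2, h3⟩
    have hp : p ∈ convexHull ℝ {p, q, r} := subset_convexHull _ _ (by simp)
    have hq : q ∈ convexHull ℝ {p, q, r} := subset_convexHull _ _ (by simp)
    have hr : r ∈ convexHull ℝ {p, q, r} := subset_convexHull _ _ (by simp)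
    have hD : triDet p q r = triDet q r x + triDet r p x + triDet p q x := by
      simp only [triDet]; ring
    have key := (convex_convexHull ℝ {p, q, r}).sum_mem (t := Finset.univ)
      (w := ![triDet q r x / triDet p q r, triDet r p x / triDet p q r,
        triDet p q x / triDet p q r]) (z := ![p, q, r])
      (by intro i _; fin_cases i <;> simp <;> positivity)
      (by simp [Fin.sum_univ_three]; rw [← add_div, ← add_div, ← hD, div_self h.ne'])
      (by intro i _; fin_cases i <;> simpa)
    convert key using 1
    simp only [Fin.sum_univ_three, Matrix.cons_val_zero, Matrix.cons_val_one, Matrix.cons_val_two,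
      Matrix.head_cons, Matrix.tail_cons]
    refine Prod.ext ?_ ?_
    all_goals
      simp only [Prod.fst_add, Prod.snd_add, Prod.smul_fst, Prod.smul_snd, smul_eq_mul]
      field_simp
      simp only [triDet]
      ring

theorem mem_interior_triangle {p q r x : ℝ × ℝ} (h1 : 0 < triDet p q x) (h2 : 0 < triDet q r x)
    (h3 : 0 < triDet r p x) : x ∈ interior (convexHull ℝ {p, q, r}) := by
  have hD : triDet p q r = triDet q r x + triDet r p x + triDet p q x := by
    simp only [triDet]; ring
  refine mem_interior.2 ⟨{x | 0 < triDet p q x ∧ 0 < triDet q r x ∧ 0 < triDet r p x}, ?_, ?_,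
    h1, h2, h3⟩
  · rintro y ⟨h1, h2, h3⟩
    exact (mem_convexHull_triangle_iff (by rw [hD]; positivity)).2 ⟨h1.le, h2.le, h3.le⟩
  · have := fun a b => isOpen_lt continuous_const (continuous_triDet a b) (f := fun _ => (0 : ℝ))
    exact (this p q).inter ((this q r).inter (this r p))

theorem segment_subset_frontier_triangle {p q r : ℝ × ℝ} (h : triDet p q r ≠ 0) :
    segment ℝ p q ⊆ frontier (convexHull ℝ {p, q, r}) := by
  have h0 : triDet p q p = 0 := by simp only [triDet]; ring
  have h1 : triDet p q q = 0 := by simp only [triDet]; ring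
  intro x hx
  rw [((Set.toFinite {p, q, r}).isClosed_convexHull ℝ).frontier_eq]
  refine ⟨segment_subset_convexHull (by simp) (by simp) hx, fun hi => ?_⟩
  have hx0 : triDet p q x = 0 := by
    obtain ⟨a, b, -, -, hab, rfl⟩ := hx
    rw [triDet_combo _ _ _ _ hab, h0, h1]; ring
  have hsub : convexHull ℝ {p, q, r} ⊆ {y | 0 ≤ triDet p q r * triDet p q y} := by
    refine convexHull_min ?_ ?_
    · rintro y (rfl | rfl | rfl)
      · simp [h0]
      · simp [h1]
      · exact mul_self_nonneg (triDet p q _)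
    · intro y hy z hz a b ha hb hab
      simp only [Set.mem_ofPred_eq, triDet_combo _ _ _ _ hab] at *
      nlinarith [mul_nonneg ha hy, mul_nonneg hb hz]
  have hlim : Filter.Tendsto (fun t : ℝ => (1 + t) • x + (-t) • r) (nhdsWithin 0 (Set.Ioi 0))
      (nhds x) := by
    have : Continuous fun t : ℝ => (1 + t) • x + (-t) • r := by fun_prop
    simpa using (this.tendsto 0).mono_left nhdsWithin_le_nhds
  obtain ⟨t, ht, ht0⟩ := ((hlim.eventually (isOpen_interior.mem_nhds hi)).and
    self_mem_nhdsWithin).exists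
  have := hsub (interior_subset ht)
  rw [Set.mem_ofPred_eq, triDet_combo _ _ _ _ (by ring), hx0] at this
  have h2 : 0 < triDet p q r * triDet p q r := mul_self_pos.2 h
  nlinarith [mul_pos ht0 h2]

theorem IsFaceOf.eq_or_subset_frontier {F Δ : Set (ℝ × ℝ)} (h : IsFaceOf F Δ) :
    F = Δ ∨ F ⊆ frontier Δ := by
  obtain ⟨p, q, r, hi, rfl, h⟩ := h
  rw [affineIndependent_iff_triDet_ne_zero] at hi
  have h1 := segment_subset_frontier_triangle hi
  have h2 : segment ℝ q r ⊆ frontier (convexHull ℝ {p, q, r}) := by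
    have : ({p, q, r} : Set (ℝ × ℝ)) = {q, r, p} := by grind
    rw [this]
    exact segment_subset_frontier_triangle (by rwa [triDet_rotate])
  have h3 : segment ℝ p r ⊆ frontier (convexHull ℝ {p, q, r}) := by
    have : ({p, q, r} : Set (ℝ × ℝ)) = {r, p, q} := by grind
    rw [this, segment_symm]
    exact segment_subset_frontier_triangle (by rwa [triDet_rotate, triDet_rotate])
  rcases h with rfl | rfl | rfl | rfl | rfl | rfl | rfl | rfl
  · exact Or.inr (Set.empty_subset _)
  · exact Or.inr (Set.singleton_subset_iff.2 (h1 (left_mem_segment ..)))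
  · exact Or.inr (Set.singleton_subset_iff.2 (h2 (left_mem_segment ..)))
  · exact Or.inr (Set.singleton_subset_iff.2 (h2 (right_mem_segment ..)))
  · exact Or.inr h1
  · exact Or.inr h2
  · exact Or.inr h3
  · exact Or.inl rfl

theorem isFaceOf_convexHull {p q r : ℝ × ℝ} (h : triDet p q r ≠ 0) {A : Set (ℝ × ℝ)}
    (hA : A ⊆ {p, q, r}) : IsFaceOf (convexHull ℝ A) (convexHull ℝ {p, q, r}) := by
  refine ⟨p, q, r, affineIndependent_iff_triDet_ne_zero.2 h, rfl, ?_⟩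
  simp only [← convexHull_pair]
  have hA' : ∀ x, x ∈ A → x = p ∨ x = q ∨ x = r := fun x hx => by simpa using hA hx
  by_cases hp : p ∈ A <;> by_cases hq : q ∈ A <;> by_cases hr : r ∈ A
  · rw [show A = {p, q, r} by grind]; simp
  · rw [show A = {p, q} by grind]; simp
  · rw [show A = {p, r} by grind]; simp
  · rw [show A = {p} by grind]; simp
  · rw [show A = {q, r} by grind]; simp
  · rw [show A = {q} by grind]; simp
  · rw [show A = {r} by grind]; simp
  · rw [show A = ∅ by grind]; simp

theorem mem_convexHull_of_max {E : Type*} [AddCommGroup E] [Module ℝ E] {V : Set E} (φ : E →ₗ[ℝ] ℝ)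
    {c : ℝ} (h : ∀ v ∈ V, φ v ≤ c) {x : E} (hx : x ∈ convexHull ℝ V) (hc : c ≤ φ x) :
    x ∈ convexHull ℝ {v ∈ V | φ v = c} := by
  suffices convexHull ℝ V ⊆ {y | φ y < c ∨ φ y = c ∧ y ∈ convexHull ℝ {v ∈ V | φ v = c}} from
    ((this hx).resolve_left hc.not_gt).2
  refine convexHull_min (fun v hv => ?_) (convex_iff_forall_pos.2 ?_)
  · exact (h v hv).lt_or_eq.imp_right fun hc => ⟨hc, subset_convexHull _ _ ⟨hv, hc⟩⟩
  · intro y hy z hz a b ha hb hab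
    have hc : c = a * c + b * c := by rw [← add_mul, hab, one_mul]
    simp only [Set.mem_ofPred_eq, map_add, map_smul, smul_eq_mul] at *
    rcases hy with hy | ⟨hy, hy'⟩
    · have hz : φ z ≤ c := hz.elim le_of_lt fun h => h.1.le
      left
      nlinarith [mul_lt_mul_of_pos_left hy ha, mul_le_mul_of_nonneg_left hz hb.le]
    · rcases hz with hz | ⟨hz, hz'⟩
      · left
        nlinarith [mul_lt_mul_of_pos_left hz hb]
      · right
        exact ⟨by rw [hy, hz, ← hc], convex_convexHull _ _ hy' hz' ha.le hb.le hab⟩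

/-- Two sets separated by a line which meets the first in points of the second only. -/
theorem convexHull_inter_of_separated {E : Type*} [AddCommGroup E] [Module ℝ E] {V W : Set E}
    (φ : E →ₗ[ℝ] ℝ) {c : ℝ} (hV : ∀ v ∈ V, φ v ≤ c) (hW : ∀ w ∈ W, c ≤ φ w)
    (h : (∀ w ∈ W, c < φ w) ∨ ∀ v ∈ V, φ v = c → v ∈ W) :
    convexHull ℝ V ∩ convexHull ℝ W = convexHull ℝ (V ∩ W) := by
  refine Set.Subset.antisymm ?_ (Set.subset_inter (convexHull_mono Set.inter_subset_left)
    (convexHull_mono Set.inter_subset_right))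
  rintro x ⟨hxV, hxW⟩
  rcases h with h | h
  · have h1 : φ x ≤ c := convexHull_min hV (convex_halfSpace_le φ.isLinear c) hxV
    have h2 : c < φ x := convexHull_min h (convex_halfSpace_gt φ.isLinear c) hxW
    exact absurd h1 h2.not_ge
  · have hc : c ≤ φ x := convexHull_min hW (convex_halfSpace_ge φ.isLinear c) hxW
    have hsub : {v ∈ V | φ v = c} ⊆ V ∩ W := fun v hv => ⟨hv.1, h v hv.1 hv.2⟩
    exact convexHull_mono hsub (mem_convexHull_of_max φ hV hxV hc)

theorem volume_standard_triangle :
    MeasureTheory.volume {x : ℝ × ℝ | 0 ≤ x.1 ∧ 0 ≤ x.2 ∧ x.1 + x.2 ≤ 1} =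
      ENNReal.ofReal (1 / 2) := by
  have hm : MeasurableSet {x : ℝ × ℝ | 0 ≤ x.1 ∧ 0 ≤ x.2 ∧ x.1 + x.2 ≤ 1} :=
    (measurableSet_le measurable_const measurable_fst).inter
      ((measurableSet_le measurable_const measurable_snd).inter
        (measurableSet_le (measurable_fst.add measurable_snd) measurable_const))
  have slice : ∀ a : ℝ, MeasureTheory.volume
      (Prod.mk a ⁻¹' {x : ℝ × ℝ | 0 ≤ x.1 ∧ 0 ≤ x.2 ∧ x.1 + x.2 ≤ 1}) =
      (Set.Icc (0 : ℝ) 1).indicator (fun a => ENNReal.ofReal (1 - a)) a := by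
    intro a
    by_cases ha : a ∈ Set.Icc (0 : ℝ) 1
    · have : Prod.mk a ⁻¹' {x : ℝ × ℝ | 0 ≤ x.1 ∧ 0 ≤ x.2 ∧ x.1 + x.2 ≤ 1} =
          Set.Icc 0 (1 - a) := by
        ext b
        simp [ha.1, le_sub_iff_add_le']
      rw [Set.indicator_of_mem ha, this, Real.volume_Icc, sub_zero]
    · have : Prod.mk a ⁻¹' {x : ℝ × ℝ | 0 ≤ x.1 ∧ 0 ≤ x.2 ∧ x.1 + x.2 ≤ 1} = ∅ := by
        refine Set.eq_empty_of_forall_notMem fun b hb => ha ?_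
        obtain ⟨h1, h2, h3⟩ := hb
        exact ⟨h1, by simp only at h2 h3; linarith⟩
      rw [Set.indicator_of_notMem ha, this, MeasureTheory.measure_empty]
  rw [MeasureTheory.Measure.volume_eq_prod, MeasureTheory.Measure.prod_apply hm]
  simp only [slice]
  rw [MeasureTheory.lintegral_indicator measurableSet_Icc,
    ← MeasureTheory.ofReal_integral_eq_lintegral_ofReal, MeasureTheory.integral_Icc_eq_integral_Ioc,
    ← intervalIntegral.integral_of_le zero_le_one]
  · rw [intervalIntegral.integral_sub (by simp) (by simp), integral_id,
      intervalIntegral.integral_const]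
    norm_num
  · exact (continuous_const.sub continuous_id).integrableOn_Icc
  · refine (MeasureTheory.ae_restrict_iff' measurableSet_Icc).2 (Filter.Eventually.of_forall ?_)
    exact fun a ha => sub_nonneg.2 ha.2

theorem volume_triangle (p q r : ℝ × ℝ) :
    MeasureTheory.volume (convexHull ℝ {p, q, r}) = ENNReal.ofReal (|triDet p q r| / 2) := by
  set L : ℝ × ℝ →ₗ[ℝ] ℝ × ℝ := Matrix.toLin (Module.Basis.finTwoProd ℝ) (Module.Basis.finTwoProd ℝ)
    !![q.1 - p.1, r.1 - p.1; q.2 - p.2, r.2 - p.2] with hL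
  have hdet : LinearMap.det L = triDet p q r := by
    rw [hL, LinearMap.det_toLin, Matrix.det_fin_two_of, triDet]
    ring
  have hstd : convexHull ℝ {((0 : ℝ), (0 : ℝ)), (1, 0), (0, 1)} =
      {x : ℝ × ℝ | 0 ≤ x.1 ∧ 0 ≤ x.2 ∧ x.1 + x.2 ≤ 1} := by
    ext x
    rw [mem_convexHull_triangle_iff (by norm_num [triDet])]
    simp only [triDet, Set.mem_ofPred_eq]
    constructor
    · rintro ⟨h1, h2, h3⟩
      exact ⟨by linarith, by linarith, by linarith⟩
    · rintro ⟨h1, h2, h3⟩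
      exact ⟨by linarith, by linarith, by linarith⟩
  have himage : convexHull ℝ {p, q, r} =
      (fun x => -p + x) ⁻¹' (L '' convexHull ℝ {((0 : ℝ), (0 : ℝ)), (1, 0), (0, 1)}) := by
    rw [L.image_convexHull, ← Set.image_add_left, ← Set.singleton_add,
      ← convexHull_singleton (𝕜 := ℝ) p, ← convexHull_add]
    congr 1
    have : ∀ s : ℝ × ℝ, p + (s.1 - p.1, s.2 - p.2) = s := fun s => by ext <;> simp
    simp [Set.image_insert_eq, hL, Matrix.toLin_finTwoProd_apply, this, ← Prod.zero_eq_mk]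
  rw [himage, MeasureTheory.measure_preimage_add, MeasureTheory.Measure.addHaar_image_linearMap,
    hstd, volume_standard_triangle, hdet, ← ENNReal.ofReal_mul (abs_nonneg _), mul_one_div]

theorem IsUnimodularTriangle.volume_eq {Δ : Set (ℝ × ℝ)} (h : IsUnimodularTriangle Δ) :
    MeasureTheory.volume Δ = ENNReal.ofReal (1 / 2) := by
  obtain ⟨p, q, r, -, -, -, -, rfl, h⟩ := h
  rw [volume_triangle, h]

theorem IsUnimodularTriangle.convex {Δ : Set (ℝ × ℝ)} (h : IsUnimodularTriangle Δ) :
    Convex ℝ Δ := by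
  obtain ⟨p, q, r, -, -, -, -, rfl, -⟩ := h
  exact convex_convexHull _ _

theorem IsUnimodularTriangle.isClosed {Δ : Set (ℝ × ℝ)} (h : IsUnimodularTriangle Δ) :
    IsClosed Δ := by
  obtain ⟨p, q, r, -, -, -, -, rfl, -⟩ := h
  exact (Set.toFinite {p, q, r}).isClosed_convexHull ℝ

/-- Unimodular triangles meeting in common faces have total area half their number. -/
theorem volume_sUnion_unimodular {T : Set (Set (ℝ × ℝ))} (hT : T.Finite)
    (hu : ∀ Δ ∈ T, IsUnimodularTriangle Δ)
    (hf : ∀ Δ₁ ∈ T, ∀ Δ₂ ∈ T, IsFaceOf (Δ₁ ∩ Δ₂) Δ₁ ∧ IsFaceOf (Δ₁ ∩ Δ₂) Δ₂) :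
    MeasureTheory.volume (⋃₀ T) = ENNReal.ofReal (T.ncard / 2) := by
  have hd : T.Pairwise (Function.onFun (MeasureTheory.AEDisjoint MeasureTheory.volume) id) := by
    intro Δ₁ h₁ Δ₂ h₂ hne
    have null : ∀ {Δ}, Δ ∈ T → Δ₁ ∩ Δ₂ ⊆ frontier Δ → MeasureTheory.volume (Δ₁ ∩ Δ₂) = 0 :=
      fun h hs => MeasureTheory.measure_mono_null hs ((hu _ h).convex.addHaar_frontier _)
    rcases (hf _ h₁ _ h₂).1.eq_or_subset_frontier with e₁ | e₁
    · rcases (hf _ h₁ _ h₂).2.eq_or_subset_frontier with e₂ | e₂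
      · exact absurd (e₁.symm.trans e₂) hne
      · exact null h₂ e₂
    · exact null h₁ e₁
  have := hT.fintype
  have hm : ∀ Δ ∈ T, MeasureTheory.NullMeasurableSet (id Δ) MeasureTheory.volume :=
    fun Δ h => (hu Δ h).isClosed.measurableSet.nullMeasurableSet
  rw [Set.sUnion_eq_biUnion]
  refine (MeasureTheory.measure_biUnion₀ hT.countable hd hm).trans ?_
  simp only [id]
  rw [tsum_fintype, Finset.sum_congr rfl fun (Δ : T) _ => (hu Δ Δ.2).volume_eq, Finset.sum_const,
    Finset.card_univ, ← Nat.card_eq_fintype_card, Nat.card_coe_set_eq, nsmul_eq_mul,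
    ← ENNReal.ofReal_natCast, ← ENNReal.ofReal_mul (Nat.cast_nonneg _), mul_one_div]

theorem volume_square (n : ℕ) :
    MeasureTheory.volume (Set.Icc ((0 : ℝ), (0 : ℝ)) ((n : ℝ), (n : ℝ))) =
      ENNReal.ofReal (n * n) := by
  rw [← Set.Icc_prod_Icc, MeasureTheory.Measure.volume_eq_prod, MeasureTheory.Measure.prod_prod,
    Real.volume_Icc, sub_zero, ENNReal.ofReal_mul (Nat.cast_nonneg _)]

/-- A closed subset of full finite volume of a convex body is everything. -/
theorem eq_of_isClosed_of_volume_le {K P : Set (ℝ × ℝ)} (hK : IsClosed K) (hKP : K ⊆ P)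
    (hP : Convex ℝ P) (hne : (interior P).Nonempty)
    (hfin : MeasureTheory.volume P ≠ ⊤)
    (h : MeasureTheory.volume P ≤ MeasureTheory.volume K) : K = P := by
  have h0 : MeasureTheory.volume (P \ K) = 0 := by
    rw [MeasureTheory.measure_sdiff hKP hK.measurableSet.nullMeasurableSet
      (ne_top_of_le_ne_top hfin (MeasureTheory.measure_mono hKP)), tsub_eq_zero_of_le h]
  have h1 : interior P \ K = ∅ := by
    refine ((isOpen_interior.sdiff hK).measure_eq_zero_iff MeasureTheory.volume).1 ?_
    exact MeasureTheory.measure_mono_null (Set.sdiff_subset_sdiff_left interior_subset) h0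
  refine hKP.antisymm ?_
  calc P ⊆ closure P := subset_closure
    _ = closure (interior P) := (hP.closure_interior_eq_closure_of_nonempty_interior hne).symm
    _ ⊆ K := hK.closure_subset_iff.2 (Set.sdiff_eq_empty.1 h1)

theorem weightAfter_gridTriangles :
    Nat.beq (forceList (gridTriangles.map mask) fun ms =>
      weightAfter ms 18 [(2 ^ 331 - 1, 1)]) 46456 = true := by
  decide +kernel

theorem samplePoints_generic :
    (gridTriangles.all fun t => samplePoints.all fun s => !inClosed t s || inOpen t s) = true := by
  decide +kernel

theorem gridTriangles_all_any_inClosed :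
    (gridTriangles.all fun t => samplePoints.any (inClosed t)) = true := by
  decide +kernel

theorem pairwiseB_pairOk : withMasks gridTriangles (pairwiseB pairOk) = true := by
  decide +kernel

theorem directions_bound :
    (directions.all fun d => gridPoints.all fun p =>
      Nat.ble (d.2.1 * p.1 + d.2.2 * p.2) (50 + (d.1.1 * p.1 + d.1.2 * p.2))) = true := by
  decide +kernel

theorem length_samplePoints : samplePoints.length = 331 := by
  decide +kernel

theorem samplePoints_bound :
    (samplePoints.all fun s => Nat.ble s.1 60 && Nat.ble s.2 60) = true := by
  decide +kernel

/-- Some rotation of a positively oriented triple of area `1/2` starts from its least point. -/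
theorem exists_rotation :
    (gridPoints.all fun p => gridPoints.all fun q => gridPoints.all fun r =>
      !isUnimodular p q r || [(p, q, r), (q, r, p), (r, p, q)].any fun t =>
        isUnimodular t.1 t.2.1 t.2.2 && (Nat.blt (gridIndex t.1) (gridIndex t.2.1) &&
          Nat.blt (gridIndex t.1) (gridIndex t.2.2))) = true := by
  decide +kernel

theorem mem_gridPoints {p : ℕ × ℕ} : p ∈ gridPoints ↔ p.1 ≤ 3 ∧ p.2 ≤ 3 := by
  constructor
  · have : ∀ p ∈ gridPoints, p.1 ≤ 3 ∧ p.2 ≤ 3 := by decide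
    exact this p
  · obtain ⟨a, b⟩ := p
    rintro ⟨h1, h2⟩
    simp only at h1 h2
    interval_cases a <;> interval_cases b <;> decide

theorem mem_gridTriangles {t : GridTriple} :
    t ∈ gridTriangles ↔ (t.1 ∈ gridPoints ∧ t.2.1 ∈ gridPoints ∧ t.2.2 ∈ gridPoints) ∧
      isUnimodular t.1 t.2.1 t.2.2 = true ∧ gridIndex t.1 < gridIndex t.2.1 ∧
        gridIndex t.1 < gridIndex t.2.2 := by
  obtain ⟨p, q, r⟩ := t
  simp only [gridTriangles, List.mem_flatMap, List.mem_map, List.mem_filter, Prod.mk.injEq,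
    Bool.and_eq_true, Nat.blt_eq]
  constructor
  · rintro ⟨p, hp, q, ⟨hq, hpq⟩, r, ⟨hr, hpr, h⟩, rfl, rfl, rfl⟩
    exact ⟨⟨hp, hq, hr⟩, h, hpq, hpr⟩
  · rintro ⟨⟨hp, hq, hr⟩, h, hpq, hpr⟩
    exact ⟨p, hp, q, ⟨hq, hpq⟩, r, ⟨hr, hpr, h⟩, rfl, rfl, rfl⟩

/-- A grid point as a vector. -/
def latticeVec (p : ℕ × ℕ) : ℝ × ℝ := (p.1, p.2)

/-- The point `s / 20`. -/
def sampleVec (s : ℕ × ℕ) : ℝ × ℝ := (s.1 / 20, s.2 / 20)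

/-- The triangle spanned by a triple of grid points. -/
def hull (t : GridTriple) : Set (ℝ × ℝ) :=
  convexHull ℝ {latticeVec t.1, latticeVec t.2.1, latticeVec t.2.2}

theorem isUnimodular_iff {p q r : ℕ × ℕ} :
    isUnimodular p q r = true ↔ triDet (latticeVec p) (latticeVec q) (latticeVec r) = 1 := by
  rw [isUnimodular, Nat.beq_eq, ← Nat.cast_inj (R := ℝ)]
  simp only [triDet, latticeVec]
  push_cast
  constructor <;> intro h <;> linarith

theorem onLeft_iff {p q s : ℕ × ℕ} :
    onLeft p q s = true ↔ 0 ≤ triDet (latticeVec p) (latticeVec q) (sampleVec s) := by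
  rw [onLeft, Nat.ble_eq, ← Nat.cast_le (α := ℝ)]
  simp only [triDet, latticeVec, sampleVec, Nat.add_eq, Nat.mul_eq]
  push_cast
  constructor <;> intro h <;> linarith

theorem strictlyOnLeft_iff {p q s : ℕ × ℕ} :
    strictlyOnLeft p q s = true ↔ 0 < triDet (latticeVec p) (latticeVec q) (sampleVec s) := by
  rw [strictlyOnLeft, Nat.blt_eq, ← Nat.cast_lt (α := ℝ)]
  simp only [triDet, latticeVec, sampleVec, Nat.add_eq, Nat.mul_eq]
  push_cast
  constructor <;> intro h <;> linarith

theorem triDet_of_mem {t : GridTriple} (ht : t ∈ gridTriangles) :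
    triDet (latticeVec t.1) (latticeVec t.2.1) (latticeVec t.2.2) = 1 :=
  isUnimodular_iff.1 (mem_gridTriangles.1 ht).2.1

theorem inClosed_iff {t : GridTriple} (ht : t ∈ gridTriangles) {s : ℕ × ℕ} :
    inClosed t s = true ↔ sampleVec s ∈ hull t := by
  rw [hull, mem_convexHull_triangle_iff (by rw [triDet_of_mem ht]; exact one_pos), inClosed,
    Bool.and_eq_true, Bool.and_eq_true, onLeft_iff, onLeft_iff, onLeft_iff]

theorem mem_interior_of_inOpen {t : GridTriple} {s : ℕ × ℕ} (h : inOpen t s = true) :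
    sampleVec s ∈ interior (hull t) := by
  rw [inOpen, Bool.and_eq_true, Bool.and_eq_true, strictlyOnLeft_iff, strictlyOnLeft_iff,
    strictlyOnLeft_iff] at h
  exact mem_interior_triangle h.1 h.2.1 h.2.2

theorem mem_interior_of_mem_hull {t : GridTriple} (ht : t ∈ gridTriangles) {s : ℕ × ℕ}
    (hs : s ∈ samplePoints) (h : sampleVec s ∈ hull t) : sampleVec s ∈ interior (hull t) := by
  have := List.all_eq_true.1 (List.all_eq_true.1 samplePoints_generic t ht) s hs
  rw [(inClosed_iff ht).2 h] at this
  exact mem_interior_of_inOpen this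

theorem testBit_maskOn (t : GridTriple) (l : List (ℕ × ℕ)) (i : ℕ) :
    (maskOn t l).testBit i = l[i]?.any (inClosed t) := by
  induction l generalizing i with
  | nil => simp [maskOn]
  | cons s l ih =>
    have h2 : ∀ n, (2 * n + 1) / 2 = n := by omega
    rw [maskOn, Nat.add_eq, Nat.mul_eq]
    cases hs : inClosed t s <;> cases i <;>
      simp [hs, ih, Nat.testBit_succ, h2]

theorem mask_ne_zero {t : GridTriple} (ht : t ∈ gridTriangles) : mask t ≠ 0 := by
  intro h
  obtain ⟨s, hs, hts⟩ := List.any_eq_true.1 (List.all_eq_true.1 gridTriangles_all_any_inClosed t ht)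
  obtain ⟨i, hi⟩ := List.mem_iff_getElem?.1 hs
  have := testBit_maskOn t samplePoints i
  rw [hi, Option.any_some, hts] at this
  rw [mask] at h
  simp [h] at this

theorem mask_eq_of_hull_eq {t u : GridTriple} (ht : t ∈ gridTriangles) (hu : u ∈ gridTriangles)
    (h : hull t = hull u) : mask t = mask u := by
  refine Nat.eq_of_testBit_eq fun i => ?_
  have : inClosed t = inClosed u := by
    funext s
    rw [Bool.eq_iff_iff, inClosed_iff ht, inClosed_iff hu, h]
  rw [mask, mask, testBit_maskOn, testBit_maskOn, this]

theorem hull_eq_convexHull_image (t : GridTriple) :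
    hull t = convexHull ℝ (latticeVec '' {p | p ∈ vertexList t}) := by
  rw [hull]
  congr 1
  ext x
  simp [vertexList, eq_comm]

/-- The linear functional with normal vector `d`. -/
def functional (d : (ℕ × ℕ) × (ℕ × ℕ)) : ℝ × ℝ →ₗ[ℝ] ℝ :=
  ((d.1.1 : ℝ) - d.2.1) • LinearMap.fst ℝ ℝ ℝ + ((d.1.2 : ℝ) - d.2.2) • LinearMap.snd ℝ ℝ ℝ

theorem functional_latticeVec {d : (ℕ × ℕ) × (ℕ × ℕ)} (hd : d ∈ directions) {p : ℕ × ℕ}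
    (hp : p ∈ gridPoints) : functional d (latticeVec p) = score d p - 50 := by
  have := List.all_eq_true.1 (List.all_eq_true.1 directions_bound d hd) p hp
  rw [Nat.ble_eq] at this
  have h : ((score d p : ℕ) : ℝ) =
      50 + (d.1.1 * p.1 + d.1.2 * p.2) - (d.2.1 * p.1 + d.2.2 * p.2) := by
    simp only [score, Nat.add_eq, Nat.mul_eq, Nat.sub_eq]
    rw [Nat.cast_sub this]
    push_cast
    ring
  rw [h]
  simp [functional, latticeVec]
  ring

theorem le_foldl_max (l : List ℕ) (a : ℕ) : a ≤ l.foldl max a ∧ ∀ n ∈ l, n ≤ l.foldl max a := by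
  induction l generalizing a with
  | nil => simp
  | cons b l ih =>
    obtain ⟨h1, h2⟩ := ih (max a b)
    simp only [List.foldl_cons, List.mem_cons, forall_eq_or_imp]
    exact ⟨(le_max_left _ _).trans h1, (le_max_right _ _).trans h1, h2⟩

theorem convexHull_inter_of_separates {V W : List (ℕ × ℕ)} {d : (ℕ × ℕ) × (ℕ × ℕ)}
    (hd : d ∈ directions) (hV : ∀ v ∈ V, v ∈ gridPoints) (hW : ∀ w ∈ W, w ∈ gridPoints)
    (h : separates V W d = true) :
    convexHull ℝ (latticeVec '' {p | p ∈ V}) ∩ convexHull ℝ (latticeVec '' {p | p ∈ W}) =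
      convexHull ℝ (latticeVec '' {p | p ∈ V} ∩ latticeVec '' {p | p ∈ W}) := by
  rw [separates, force_eq] at h
  generalize hc : (V.map (score d)).foldl max 0 = c at h
  simp only [Bool.and_eq_true, Bool.or_eq_true, List.all_eq_true, Nat.ble_eq, Nat.blt_eq,
    decide_eq_true_iff] at h
  have hVc : ∀ v ∈ V, score d v ≤ c := fun v hv =>
    hc ▸ (le_foldl_max (V.map (score d)) 0).2 _ (List.mem_map_of_mem hv)
  refine convexHull_inter_of_separated (functional d) (c := (c : ℝ) - 50) ?_ ?_ ?_
  · rintro _ ⟨v, hv, rfl⟩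
    rw [functional_latticeVec hd (hV v hv), sub_le_sub_iff_right, Nat.cast_le]
    exact hVc v hv
  · rintro _ ⟨w, hw, rfl⟩
    rw [functional_latticeVec hd (hW w hw), sub_le_sub_iff_right, Nat.cast_le]
    exact h.1 w hw
  · refine h.2.imp ?_ ?_
    · rintro h _ ⟨w, hw, rfl⟩
      rw [functional_latticeVec hd (hW w hw), sub_lt_sub_iff_right, Nat.cast_lt]
      exact h w hw
    · rintro h _ ⟨v, hv, rfl⟩ he
      rw [functional_latticeVec hd (hV v hv), sub_left_inj, Nat.cast_inj] at he
      exact ⟨v, (h.1 v hv).resolve_left he.not_lt, rfl⟩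

theorem pairwise_of_pairwiseB {α : Type} {r : α → α → Bool} {l : List α}
    (h : pairwiseB r l = true) : l.Pairwise fun a b => r a b = true := by
  induction l with
  | nil => exact List.Pairwise.nil
  | cons a l ih =>
    rw [pairwiseB, Bool.and_eq_true, List.all_eq_true] at h
    exact List.Pairwise.cons h.1 (ih h.2)

theorem withMasks_eq (l : List GridTriple) (k : List (ℕ × GridTriple) → Bool) :
    withMasks l k = k (l.map fun t => (mask t, t)) := by
  induction l generalizing k with
  | nil => rfl
  | cons t l ih =>
    change force (mask t) (fun m => withMasks l fun l => k ((m, t) :: l)) = _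
    rw [force_eq, ih, List.map_cons]

theorem pairwise_pairOk :
    gridTriangles.Pairwise fun t u => pairOk (mask t, t) (mask u, u) = true := by
  have := pairwiseB_pairOk
  rw [withMasks_eq] at this
  exact List.pairwise_map.1 (pairwise_of_pairwiseB this)

theorem pairOk_iff {t u : GridTriple} : pairOk (mask t, t) (mask u, u) = true ↔
    mask t ≠ mask u ∧ (mask t &&& mask u ≠ 0 ∨
      ∃ d ∈ directions, separates (vertexList t) (vertexList u) d = true) := by
  simp only [pairOk, Bool.and_eq_true, Bool.or_eq_true, Bool.not_eq_true', List.any_eq_true,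
    ← Bool.not_eq_true, Nat.beq_eq]
  rfl

theorem nodup_gridTriangles : gridTriangles.Nodup :=
  pairwise_pairOk.imp (S := (· ≠ ·)) fun h e => (pairOk_iff.1 h).1 (congrArg mask e)

theorem vertexList_subset {t : GridTriple} (ht : t ∈ gridTriangles) :
    ∀ v ∈ vertexList t, v ∈ gridPoints := by
  obtain ⟨⟨h1, h2, h3⟩, -⟩ := mem_gridTriangles.1 ht
  simp [vertexList, h1, h2, h3]

/-- Distinct triangles of the square have different masks; if these masks are disjoint, the
triangles meet in the convex hull of their common vertices. -/
theorem mask_ne_and_hull_inter {t u : GridTriple} (ht : t ∈ gridTriangles)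
    (hu : u ∈ gridTriangles) (hne : t ≠ u) :
    mask t ≠ mask u ∧ (mask t &&& mask u = 0 → hull t ∩ hull u =
      convexHull ℝ (latticeVec '' {p | p ∈ vertexList t} ∩
        latticeVec '' {p | p ∈ vertexList u})) := by
  have sep : ∀ {t u}, t ∈ gridTriangles → u ∈ gridTriangles →
      pairOk (mask t, t) (mask u, u) = true → mask t &&& mask u = 0 → hull t ∩ hull u =
        convexHull ℝ (latticeVec '' {p | p ∈ vertexList t} ∩
          latticeVec '' {p | p ∈ vertexList u}) := by
    intro t u ht hu h h0
    obtain ⟨d, hd, h⟩ := (pairOk_iff.1 h).2.resolve_left fun h => h h0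
    rw [hull_eq_convexHull_image, hull_eq_convexHull_image]
    exact convexHull_inter_of_separates hd (vertexList_subset ht) (vertexList_subset hu) h
  have := (pairwise_pairOk.imp fun h => Or.inl h :
    gridTriangles.Pairwise fun t u => pairOk (mask t, t) (mask u, u) = true ∨
      pairOk (mask u, u) (mask t, t) = true)
  have symm : Std.Symm fun t u => pairOk (mask t, t) (mask u, u) = true ∨
      pairOk (mask u, u) (mask t, t) = true := ⟨fun _ _ h => h.symm⟩
  rcases this.forall ht hu hne with h | h
  · exact ⟨(pairOk_iff.1 h).1, sep ht hu h⟩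
  · refine ⟨(pairOk_iff.1 h).1.symm, fun h0 => ?_⟩
    rw [Set.inter_comm, Set.inter_comm (latticeVec '' _)]
    exact sep hu ht h (by rwa [Nat.land_comm])

theorem hull_injOn : Set.InjOn hull {t | t ∈ gridTriangles} := by
  intro t ht u hu h
  by_contra hne
  exact (mask_ne_and_hull_inter ht hu hne).1 (mask_eq_of_hull_eq ht hu h)

theorem isFaceOf_hull_inter {t u : GridTriple} (ht : t ∈ gridTriangles) (hu : u ∈ gridTriangles)
    (h : t ≠ u → mask t &&& mask u = 0) :
    IsFaceOf (hull t ∩ hull u) (hull t) ∧ IsFaceOf (hull t ∩ hull u) (hull u) := by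
  have face : ∀ {t}, t ∈ gridTriangles → ∀ {A}, A ⊆ latticeVec '' {p | p ∈ vertexList t} →
      IsFaceOf (convexHull ℝ A) (hull t) := by
    intro t ht A hA
    refine isFaceOf_convexHull (by rw [triDet_of_mem ht]; exact one_ne_zero) (hA.trans ?_)
    rintro _ ⟨p, hp, rfl⟩
    simp only [vertexList, Set.mem_ofPred_eq, List.mem_cons, List.not_mem_nil, or_false] at hp
    rcases hp with rfl | rfl | rfl <;> simp
  by_cases hne : t = u
  · subst hne
    rw [Set.inter_self]
    have := face ht Set.Subset.rfl
    rw [← hull_eq_convexHull_image] at this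
    exact ⟨this, this⟩
  · rw [(mask_ne_and_hull_inter ht hu hne).2 (h hne)]
    exact ⟨face ht Set.inter_subset_left, face hu Set.inter_subset_right⟩

theorem isUnimodularTriangle_hull {t : GridTriple} (ht : t ∈ gridTriangles) :
    IsUnimodularTriangle (hull t) := by
  have lattice : ∀ p, IsLatticePoint (latticeVec p) := fun p => ⟨p.1, p.2, by simp [latticeVec]⟩
  have h := triDet_of_mem ht
  refine ⟨_, _, _, lattice t.1, lattice t.2.1, lattice t.2.2, ?_, rfl, by rw [h, abs_one]⟩
  rw [affineIndependent_iff_triDet_ne_zero, h]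
  exact one_ne_zero

theorem hull_subset_square {t : GridTriple} (ht : t ∈ gridTriangles) :
    hull t ⊆ Set.Icc ((0 : ℝ), (0 : ℝ)) (((3 : ℕ) : ℝ), ((3 : ℕ) : ℝ)) := by
  refine convexHull_min ?_ (convex_Icc _ _)
  have grid : ∀ p ∈ gridPoints,
      latticeVec p ∈ Set.Icc ((0 : ℝ), (0 : ℝ)) (((3 : ℕ) : ℝ), ((3 : ℕ) : ℝ)) := by
    intro p hp
    obtain ⟨h1, h2⟩ := mem_gridPoints.1 hp
    exact ⟨⟨Nat.cast_nonneg _, Nat.cast_nonneg _⟩, ⟨Nat.cast_le.2 h1, Nat.cast_le.2 h2⟩⟩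
  obtain ⟨⟨h1, h2, h3⟩, -⟩ := mem_gridTriangles.1 ht
  rintro x (rfl | rfl | rfl)
  exacts [grid _ h1, grid _ h2, grid _ h3]

theorem exists_latticeVec_eq {p : ℝ × ℝ} (hp : IsLatticePoint p)
    (h : p ∈ Set.Icc ((0 : ℝ), (0 : ℝ)) (((3 : ℕ) : ℝ), ((3 : ℕ) : ℝ))) :
    ∃ a ∈ gridPoints, latticeVec a = p := by
  obtain ⟨a, b, rfl⟩ := hp
  obtain ⟨⟨h1, h2⟩, ⟨h3, h4⟩⟩ := h
  simp only at h1 h2 h3 h4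
  lift a to ℕ using by exact_mod_cast h1
  lift b to ℕ using by exact_mod_cast h2
  exact ⟨(a, b), mem_gridPoints.2 ⟨by exact_mod_cast h3, by exact_mod_cast h4⟩, by
    simp [latticeVec]⟩

theorem exists_hull_eq_of_isUnimodular {p q r : ℕ × ℕ} (hp : p ∈ gridPoints)
    (hq : q ∈ gridPoints) (hr : r ∈ gridPoints) (h : isUnimodular p q r = true) :
    ∃ t ∈ gridTriangles, hull t = convexHull ℝ {latticeVec p, latticeVec q, latticeVec r} := by
  have := List.all_eq_true.1 (List.all_eq_true.1 (List.all_eq_true.1 exists_rotation p hp) q hq)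
    r hr
  rw [h] at this
  simp only [Bool.not_true, Bool.false_or, List.any_eq_true, Bool.and_eq_true, Nat.blt_eq] at this
  obtain ⟨t, ht, h⟩ := this
  simp only [List.mem_cons, List.not_mem_nil, or_false] at ht
  refine ⟨t, mem_gridTriangles.2 ⟨?_, h⟩, ?_⟩
  · rcases ht with rfl | rfl | rfl <;> simp [hp, hq, hr]
  · rw [hull]
    congr 1
    rcases ht with rfl | rfl | rfl <;> grind

theorem exists_hull_eq {Δ : Set (ℝ × ℝ)} (h : IsUnimodularTriangle Δ)
    (hΔ : Δ ⊆ Set.Icc ((0 : ℝ), (0 : ℝ)) (((3 : ℕ) : ℝ), ((3 : ℕ) : ℝ))) :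
    ∃ t ∈ gridTriangles, hull t = Δ := by
  obtain ⟨p, q, r, hp, hq, hr, -, rfl, hd⟩ := h
  obtain ⟨p, hp', rfl⟩ := exists_latticeVec_eq hp (hΔ (subset_convexHull _ _ (by simp)))
  obtain ⟨q, hq', rfl⟩ := exists_latticeVec_eq hq (hΔ (subset_convexHull _ _ (by simp)))
  obtain ⟨r, hr', rfl⟩ := exists_latticeVec_eq hr (hΔ (subset_convexHull _ _ (by simp)))
  rcases (abs_eq zero_le_one).1 hd with hd | hd
  · exact exists_hull_eq_of_isUnimodular hp' hq' hr' (isUnimodular_iff.2 hd)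
  · rw [Set.insert_comm]
    refine exists_hull_eq_of_isUnimodular hq' hp' hr' (isUnimodular_iff.2 ?_)
    rw [triDet_comm, hd, neg_neg]

theorem sampleVec_mem_square {s : ℕ × ℕ} (hs : s ∈ samplePoints) :
    sampleVec s ∈ Set.Icc ((0 : ℝ), (0 : ℝ)) (((3 : ℕ) : ℝ), ((3 : ℕ) : ℝ)) := by
  have := List.all_eq_true.1 samplePoints_bound s hs
  rw [Bool.and_eq_true, Nat.ble_eq, Nat.ble_eq, ← Nat.cast_le (α := ℝ),
    ← Nat.cast_le (α := ℝ)] at this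
  push_cast at this
  refine ⟨⟨by simp only [sampleVec]; positivity, by simp only [sampleVec]; positivity⟩, ?_, ?_⟩ <;>
    simp only [sampleVec] <;> push_cast <;> linarith

theorem testBit_mask {t : GridTriple} {i : ℕ} (hi : i < samplePoints.length) :
    (mask t).testBit i = inClosed t samplePoints[i] := by
  rw [mask, testBit_maskOn, List.getElem?_eq_getElem hi, Option.any_some]

/-- The families of triangles of the square whose masks partition the set of sample points
are exactly the unimodular triangulations. -/
theorem isUnimodularTriangulation_iff {X : Finset GridTriple}
    (hX : X ⊆ gridTriangles.toFinset) :
    IsUnimodularTriangulation (Set.Icc ((0 : ℝ), (0 : ℝ)) (((3 : ℕ) : ℝ), ((3 : ℕ) : ℝ)))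
      (hull '' X) ↔ X ∈ exactCovers gridTriangles.toFinset mask 18 (2 ^ 331 - 1) := by
  have hmem : ∀ {t}, t ∈ X → t ∈ gridTriangles := fun ht => List.mem_toFinset.1 (hX ht)
  have hfin : (hull '' (X : Set GridTriple)).Finite := X.finite_toSet.image _
  have hu : ∀ Δ ∈ hull '' (X : Set GridTriple), IsUnimodularTriangle Δ := by
    rintro _ ⟨t, ht, rfl⟩
    exact isUnimodularTriangle_hull (hmem ht)
  have hinj : Set.InjOn hull (X : Set GridTriple) := hull_injOn.mono fun t ht => hmem ht
  have hcard : (hull '' (X : Set GridTriple)).ncard = X.card := by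
    rw [hinj.ncard_image, Set.ncard_coe_finset]
  rw [mem_exactCovers]
  constructor
  · rintro ⟨-, -, hcover, hface⟩
    refine ⟨hX, ?_, fun i => ?_⟩
    · have h := volume_sUnion_unimodular hfin hu hface
      rw [hcover, volume_square, ENNReal.ofReal_eq_ofReal_iff (by positivity) (by positivity),
        hcard] at h
      have : (X.card : ℝ) = (18 : ℕ) := by push_cast at h ⊢; linarith
      exact_mod_cast this
    · rw [Nat.testBit_two_pow_sub_one]
      by_cases hi : i < samplePoints.length
      · have hs : samplePoints[i] ∈ samplePoints := List.getElem_mem hi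
        rw [decide_eq_true (length_samplePoints ▸ hi), Bool.toNat_true, Finset.card_eq_one]
        have hs' := sampleVec_mem_square hs
        rw [← hcover] at hs'
        obtain ⟨_, ⟨t, ht, rfl⟩, hst⟩ := hs'
        refine ⟨t, Finset.ext fun u => ?_⟩
        rw [Finset.mem_filter, Finset.mem_singleton, testBit_mask hi]
        constructor
        · rintro ⟨hu, hsu⟩
          rw [inClosed_iff (hmem hu)] at hsu
          have eq_left : ∀ {v}, v ∈ X → sampleVec samplePoints[i] ∈ hull v →
              IsFaceOf (hull t ∩ hull u) (hull v) → hull t ∩ hull u = hull v := by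
            intro v hv hsv hf
            refine hf.eq_or_subset_frontier.resolve_right fun h => ?_
            exact (h ⟨hst, hsu⟩).2 (mem_interior_of_mem_hull (hmem hv) hs hsv)
          have := hface _ ⟨t, ht, rfl⟩ _ ⟨u, hu, rfl⟩
          exact hinj hu ht ((eq_left hu hsu this.2).symm.trans (eq_left ht hst this.1))
        · rintro rfl
          exact ⟨ht, (inClosed_iff (hmem ht)).2 hst⟩
      · rw [decide_eq_false (length_samplePoints ▸ hi), Bool.toNat_false, Finset.card_eq_zero]
        refine Finset.filter_eq_empty_iff.2 fun t _ => ?_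
        rw [mask, testBit_maskOn, List.getElem?_eq_none (not_lt.1 hi)]
        simp
  · rintro ⟨-, hc, hbit⟩
    have hface : ∀ Δ₁ ∈ hull '' (X : Set GridTriple), ∀ Δ₂ ∈ hull '' (X : Set GridTriple),
        IsFaceOf (Δ₁ ∩ Δ₂) Δ₁ ∧ IsFaceOf (Δ₁ ∩ Δ₂) Δ₂ := by
      rintro _ ⟨t, ht, rfl⟩ _ ⟨u, hu, rfl⟩
      refine isFaceOf_hull_inter (hmem ht) (hmem hu) fun hne => Nat.eq_of_testBit_eq fun i => ?_
      rw [Nat.testBit_land, Nat.zero_testBit, Bool.eq_false_iff, ne_eq, Bool.and_eq_true]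
      rintro ⟨h1, h2⟩
      exact hne (Finset.card_le_one.1 ((hbit i).trans_le (Bool.toNat_le _)) t
        (Finset.mem_filter.2 ⟨ht, h1⟩) u (Finset.mem_filter.2 ⟨hu, h2⟩))
    have hsub : ∀ Δ ∈ hull '' (X : Set GridTriple),
        Δ ⊆ Set.Icc ((0 : ℝ), (0 : ℝ)) (((3 : ℕ) : ℝ), ((3 : ℕ) : ℝ)) := by
      rintro _ ⟨t, ht, rfl⟩
      exact hull_subset_square (hmem ht)
    refine ⟨hfin, fun Δ h => ⟨hu Δ h, hsub Δ h⟩, ?_, hface⟩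
    refine eq_of_isClosed_of_volume_le ?_ (Set.sUnion_subset hsub) (convex_Icc _ _) ?_ ?_ ?_
    · rw [Set.sUnion_eq_biUnion]
      exact hfin.isClosed_biUnion fun Δ h => (hu Δ h).isClosed
    · rw [← Set.Icc_prod_Icc, interior_prod_eq, interior_Icc]
      exact ⟨(1, 1), by norm_num⟩
    · rw [volume_square]
      exact ENNReal.ofReal_ne_top
    · rw [volume_square, volume_sUnion_unimodular hfin hu hface, hcard, hc]
      exact ENNReal.ofReal_le_ofReal (by norm_num)

theorem card_exactCovers_of_beq {α : Type*} [DecidableEq α] {L : List α} (hL : L.Nodup)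
    {g : α → ℕ} (hg : ∀ t ∈ L, g t ≠ 0) {n S N : ℕ}
    (h : Nat.beq (forceList (L.map g) fun ms => weightAfter ms n [(S, 1)]) N = true) :
    (exactCovers L.toFinset g n S).card = N := by
  rw [forceList_eq, weightAfter_eq hL hg] at h
  simpa [weightedSum] using Nat.eq_of_beq_eq_true h

theorem card_exactCovers_gridTriangles :
    (exactCovers gridTriangles.toFinset mask 18 (2 ^ 331 - 1)).card = 46456 := by
  have := card_exactCovers_of_beq nodup_gridTriangles (fun _ => mask_ne_zero)
    weightAfter_gridTriangles
  exact this

/-- The number of unimodular triangulations of `[0,3] × [0,3]` is `46456`. -/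
theorem f_three_three : f 3 3 = 46456 := by
  rw [f, numTriangulations, ← card_exactCovers_gridTriangles, ← Set.ncard_coe_finset]
  symm
  refine Set.ncard_congr (fun X _ => hull '' (X : Set GridTriple)) ?_ ?_ ?_
  · intro X hX
    exact (isUnimodularTriangulation_iff (mem_exactCovers.1 hX).1).2 hX
  · intro X Y hX hY h
    have sub : ∀ {Z}, Z ∈ exactCovers gridTriangles.toFinset mask 18 (2 ^ 331 - 1) →
        (Z : Set GridTriple) ⊆ {t | t ∈ gridTriangles} :=
      fun hZ t ht => List.mem_toFinset.1 ((mem_exactCovers.1 hZ).1 ht)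
    exact Finset.coe_injective ((hull_injOn.image_eq_image_iff (sub hX) (sub hY)).1 h)
  · intro T hT
    classical
    have hT' : hull '' (gridTriangles.toFinset.filter fun t => hull t ∈ T :
        Finset GridTriple) = T := by
      ext Δ
      constructor
      · rintro ⟨t, ht, rfl⟩
        exact (Finset.mem_filter.1 ht).2
      · intro hΔ
        obtain ⟨t, ht, rfl⟩ := exists_hull_eq (hT.2.1 Δ hΔ).1 (hT.2.1 Δ hΔ).2
        exact ⟨t, Finset.mem_filter.2 ⟨List.mem_toFinset.2 ht, hΔ⟩, rfl⟩
    refine ⟨_, ?_, hT'⟩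
    refine (isUnimodularTriangulation_iff (Finset.filter_subset _ _)).1 ?_
    rw [hT']
    exact hT
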